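/- arXiv:2512.21441 — 8 statements merged into one kernel-verified Lean document; each statement's English description precedes it below -/
import Mathlib

section
/- Let M ≥ 1 be an integer, let u_1, …, u_M be pairwise distinct complex numbers, let x be a complex number with x ≠ u_k for every k, and let m ∈ {1,…,M}. Then ∑_{k=1, k≠m}^{M} 1 / ((u_k − x)(u_k − u_m) · ∏_{α=1, α≠k}^{M} (u_k − u_α)) = (∑_{α=1, α≠m}^{M} 1/(u_m − u_α)) / ((u_m − x) · ∏_{k=1, k≠m}^{M} (u_m − u_k)) + 1 / ((u_m − x) · ∏_{k=1}^{M} (x − u_k)) + 1 / ((u_m − x)² · ∏_{k=1, k≠m}^{M} (u_m − u_k)). -/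
open Finset

/-- Partial fractions of the inverse of a product of distinct linear factors. -/
theorem sum_nodalWeight_mul_inv_sub {ι F : Type*} [DecidableEq ι] [Field F] {s : Finset ι}
    {v : ι → F} (hvs : Set.InjOn v s) (hs : s.Nonempty) {y : F} (hy : ∀ i ∈ s, y ≠ v i) :
    ∑ i ∈ s, Lagrange.nodalWeight s v i * (y - v i)⁻¹ = ∏ i ∈ s, (y - v i)⁻¹ := by
  have h : (∏ i ∈ s, (y - v i)) * ∑ i ∈ s, Lagrange.nodalWeight s v i * (y - v i)⁻¹ = 1 := by
    simpa [Lagrange.interpolate_one hvs hs, Lagrange.eval_nodal] using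
      (Lagrange.eval_interpolate_not_at_node 1 hy).symm
  rw [prod_inv_distrib]
  exact eq_inv_of_mul_eq_one_right h

theorem hasDerivAt_inv_sub {𝕜 : Type*} [NontriviallyNormedField 𝕜] {a c : 𝕜} (h : a ≠ c) :
    HasDerivAt (fun y => (y - c)⁻¹) (-((a - c) ^ 2)⁻¹) a := by
  simpa [neg_div] using ((hasDerivAt_id a).sub_const c).fun_inv (sub_ne_zero.2 h)

theorem hasDerivAt_prod_inv_sub {ι 𝕜 : Type*} [NontriviallyNormedField 𝕜] (s : Finset ι)
    {v : ι → 𝕜} {a : 𝕜} (h : ∀ i ∈ s, a ≠ v i) :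
    HasDerivAt (fun y => ∏ i ∈ s, (y - v i)⁻¹)
      (-((∏ i ∈ s, (a - v i)⁻¹) * ∑ i ∈ s, (a - v i)⁻¹)) a := by
  classical
  induction s using Finset.induction_on with
  | empty => simpa using hasDerivAt_const a (1 : 𝕜)
  | insert j s hj ih =>
    simp only [prod_insert hj, sum_insert hj]
    refine ((hasDerivAt_inv_sub (h j (mem_insert_self j s))).fun_mul
      (ih fun i hi => h i (mem_insert_of_mem hi))).congr_deriv ?_
    rw [← inv_pow]
    ring

/-- Partial fractions of the derivative of the inverse of a product of distinct linear factors. -/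
theorem sum_nodalWeight_mul_inv_sub_sq {ι 𝕜 : Type*} [DecidableEq ι] [NontriviallyNormedField 𝕜]
    {s : Finset ι} {v : ι → 𝕜} (hvs : Set.InjOn v s) (hs : s.Nonempty) {a : 𝕜}
    (ha : ∀ i ∈ s, a ≠ v i) :
    ∑ i ∈ s, Lagrange.nodalWeight s v i * ((a - v i) ^ 2)⁻¹ =
      (∏ i ∈ s, (a - v i)⁻¹) * ∑ i ∈ s, (a - v i)⁻¹ := by
  have h₁ : HasDerivAt (fun y => ∑ i ∈ s, Lagrange.nodalWeight s v i * (y - v i)⁻¹)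
      (∑ i ∈ s, Lagrange.nodalWeight s v i * -((a - v i) ^ 2)⁻¹) a :=
    HasDerivAt.fun_sum fun i hi => (hasDerivAt_inv_sub (ha i hi)).const_mul _
  have hev : ∀ᶠ y in nhds a, ∀ i ∈ s, y ≠ v i :=
    (Filter.eventually_all_finset s).2 fun i hi => eventually_ne_nhds (ha i hi)
  have h₂ := (hasDerivAt_prod_inv_sub s ha).congr_of_eventuallyEq
    (hev.mono fun y hy => sum_nodalWeight_mul_inv_sub hvs hs hy)
  simpa only [mul_neg, sum_neg_distrib, neg_inj] using h₁.unique h₂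

/-- Second rational identity of Lemma 4.2. -/
theorem stmt1 (M : ℕ) (hM : 1 ≤ M) (u : Fin M → ℂ) (hu : Function.Injective u)
    (x : ℂ) (hx : ∀ k, x ≠ u k) (m : Fin M) :
    ∑ k ∈ Finset.univ.erase m,
        1 / ((u k - x) * (u k - u m) * ∏ α ∈ Finset.univ.erase k, (u k - u α)) =
      (∑ α ∈ Finset.univ.erase m, 1 / (u m - u α)) /
          ((u m - x) * ∏ k ∈ Finset.univ.erase m, (u m - u k))
        + 1 / ((u m - x) * ∏ k : Fin M, (x - u k))
        + 1 / ((u m - x) ^ 2 * ∏ k ∈ Finset.univ.erase m, (u m - u k)) := by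
  have hmx : u m - x ≠ 0 := sub_ne_zero.2 (hx m).symm
  have hxm : x - u m ≠ 0 := sub_ne_zero.2 (hx m)
  rw [← mul_prod_erase univ (fun k => x - u k) (mem_univ m)]
  have hne : ∀ k ∈ univ.erase m, u m ≠ u k := fun k hk => hu.ne (ne_of_mem_erase hk).symm
  have hterm : ∀ k ∈ univ.erase m,
      1 / ((u k - x) * (u k - u m) * ∏ α ∈ univ.erase k, (u k - u α)) =
        ((u m - x) ^ 2)⁻¹ * (Lagrange.nodalWeight (univ.erase m) u k * (u m - u k)⁻¹) -
          ((u m - x) ^ 2)⁻¹ * (Lagrange.nodalWeight (univ.erase m) u k * (x - u k)⁻¹) +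
          (u m - x)⁻¹ * (Lagrange.nodalWeight (univ.erase m) u k * ((u m - u k) ^ 2)⁻¹) := by
    intro k hk
    have hmk : m ∈ univ.erase k := mem_erase.2 ⟨(ne_of_mem_erase hk).symm, mem_univ m⟩
    rw [← mul_prod_erase _ _ hmk, Lagrange.nodalWeight, prod_inv_distrib, erase_right_comm]
    have h₁ : u m - u k ≠ 0 := sub_ne_zero.2 (hne k hk)
    have h₂ : u k - u m ≠ 0 := sub_ne_zero.2 (hne k hk).symm
    have h₃ : x - u k ≠ 0 := sub_ne_zero.2 (hx k)
    have h₄ : u k - x ≠ 0 := sub_ne_zero.2 (hx k).symm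
    have hP : ∏ α ∈ (univ.erase m).erase k, (u k - u α) ≠ 0 :=
      prod_ne_zero_iff.2 fun α hα => sub_ne_zero.2 (hu.ne (ne_of_mem_erase hα).symm)
    generalize ∏ α ∈ (univ.erase m).erase k, (u k - u α) = P at hP ⊢
    field_simp
    ring
  rcases (univ.erase m).eq_empty_or_nonempty with hs | hs
  · simp only [hs, sum_empty, prod_empty]
    field_simp
    ring
  · rw [sum_congr rfl hterm, sum_add_distrib, sum_sub_distrib, ← mul_sum, ← mul_sum, ← mul_sum,
      sum_nodalWeight_mul_inv_sub hu.injOn hs hne,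
      sum_nodalWeight_mul_inv_sub hu.injOn hs fun k _ => hx k,
      sum_nodalWeight_mul_inv_sub_sq hu.injOn hs hne, prod_inv_distrib, prod_inv_distrib]
    have hP : ∏ k ∈ univ.erase m, (u m - u k) ≠ 0 :=
      prod_ne_zero_iff.2 fun k hk => sub_ne_zero.2 (hne k hk)
    have hQ : ∏ k ∈ univ.erase m, (x - u k) ≠ 0 :=
      prod_ne_zero_iff.2 fun k _ => sub_ne_zero.2 (hx k)
    simp only [one_div]
    generalize ∏ k ∈ univ.erase m, (u m - u k) = P at hP ⊢
    generalize ∏ k ∈ univ.erase m, (x - u k) = Q at hQ ⊢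
    generalize ∑ k ∈ univ.erase m, (u m - u k)⁻¹ = S
    field_simp
    ring
end

section
/- Let k ≥ 1 be an integer and let z_1, …, z_{2k} be real numbers. Then there do not exist real polynomials P and Q with P odd such that P(z)² − (∏_{j=1}^{2k} (z² − z_j²)) · Q(z)² = 1 holds as an identity of polynomials. -/
open Polynomial

/-- Proposition 8.1(i): for curves `μ² = ∏_{j=1}^{2k}(z² − z_j²)` there is no odd polynomial
solution of the Pell equation. -/
theorem stmt2 (k : ℕ) (hk : 1 ≤ k) (z : Fin (2 * k) → ℝ) :
    ¬ ∃ P Q : Polynomial ℝ,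
        P.comp (-Polynomial.X) = -P ∧
        P ^ 2 - (∏ j : Fin (2 * k), (Polynomial.X ^ 2 - Polynomial.C (z j ^ 2))) * Q ^ 2 = 1 := by
  rintro ⟨P, Q, hodd, hpell⟩
  have hP : P.eval 0 = 0 := by
    have h := congrArg (eval 0) hodd
    simp only [eval_comp, eval_neg, eval_X, neg_zero] at h
    linarith
  have hprod : ∏ j, (0 ^ 2 - z j ^ 2) = (∏ j, z j) ^ 2 := by
    simp [Finset.prod_neg, Finset.prod_pow]
  have h := congrArg (eval 0) hpell
  simp only [eval_sub, eval_mul, eval_pow, eval_prod, eval_X, eval_C, eval_one, hP, hprod] at h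
  nlinarith [sq_nonneg ((∏ j, z j) * Q.eval 0)]
end

section
/- Let k ≥ 1 and let z_1, …, z_{2k} be real numbers with 0 < z_1 < z_2 < ⋯ < z_{2k}. Let P and Q be real polynomials such that P is even, P is nonconstant, and P(z)² − (∏_{j=1}^{2k} (z² − z_j²)) · Q(z)² = 1 as polynomials. Then there exist real polynomials p̂ and q̂ such that P(z) = p̂(z²), Q(z) = q̂(z²), and p̂(w)² − (∏_{j=1}^{2k} (w − z_j²)) · q̂(w)² = 1 as polynomials in w. -/
open Polynomial

/-- A polynomial invariant under `X ↦ -X` is a polynomial in `X ^ 2`. -/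
theorem exists_eq_comp_X_sq_of_comp_neg_X_eq {R : Type*} [CommRing R] [IsDomain R] [CharZero R]
    {P : Polynomial R} (hP : P.comp (-X) = P) : ∃ p : Polynomial R, P = p.comp (X ^ 2) := by
  refine ⟨contract 2 P, ?_⟩
  rw [← expand_eq_comp_X_pow]
  ext n
  rw [coeff_expand two_pos]
  split_ifs with h
  · rw [coeff_contract two_ne_zero, Nat.div_mul_cancel h]
  · have hn : Odd n := by rwa [← Nat.not_even_iff_odd, even_iff_two_dvd]
    have hc := congrArg (coeff · n) hP
    rw [show (-X : Polynomial R) = C (-1) * X by simp] at hc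
    simp only [comp_C_mul_X_coeff, hn.neg_one_pow, mul_neg, mul_one] at hc
    exact neg_eq_self.mp hc

theorem natDegree_prod_X_sq_sub_C {R ι : Type*} [CommRing R] [Nontrivial R] [Fintype ι]
    (a : ι → R) : (∏ j, (X ^ 2 - C (a j))).natDegree = Fintype.card ι * 2 := by
  rw [natDegree_prod_of_monic _ _ fun j _ => monic_X_pow_sub_C _ two_ne_zero]
  simp

theorem even_natDegree_of_comp_neg_X_eq {R : Type*} [CommRing R] [IsDomain R] [CharZero R]
    {P : Polynomial R} (hP : P.comp (-X) = P) : Even P.natDegree := by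
  obtain ⟨p, rfl⟩ := exists_eq_comp_X_sq_of_comp_neg_X_eq hP
  simp [natDegree_comp]

theorem odd_natDegree_of_comp_neg_X_eq_neg {R : Type*} [CommRing R] [IsDomain R] [CharZero R]
    {Q : Polynomial R} (hQ : Q.comp (-X) = -Q) (hQ0 : Q ≠ 0) : Odd Q.natDegree := by
  by_contra h
  rw [Nat.not_odd_iff_even] at h
  have hc := congrArg leadingCoeff hQ
  rw [comp_neg_X_leadingCoeff_eq, h.neg_one_pow, one_mul, leadingCoeff_neg] at hc
  exact hQ0 (leadingCoeff_eq_zero.mp (self_eq_neg.mp hc))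

/-- Proposition 8.1(ii): an even nonconstant solution of the Pell equation with
`Δ(z) = ∏_{j=1}^{2k}(z² − z_j²)`, `0 < z_1 < ⋯ < z_{2k}`, descends to a solution of the
Pell equation with `Δ̂(w) = ∏_{j=1}^{2k}(w − z_j²)`. -/
theorem stmt3 (k : ℕ) (hk : 1 ≤ k) (z : Fin (2 * k) → ℝ)
    (hzpos : ∀ j, 0 < z j) (hzmono : StrictMono z)
    (P Q : Polynomial ℝ)
    (hPeven : P.comp (-Polynomial.X) = P) (hPnc : 0 < P.natDegree)
    (hPell : P ^ 2 - (∏ j : Fin (2 * k), (Polynomial.X ^ 2 - Polynomial.C (z j ^ 2))) * Q ^ 2 = 1) :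
    ∃ p q : Polynomial ℝ,
      P = p.comp (Polynomial.X ^ 2) ∧ Q = q.comp (Polynomial.X ^ 2) ∧
      p ^ 2 - (∏ j : Fin (2 * k), (Polynomial.X - Polynomial.C (z j ^ 2))) * q ^ 2 = 1 := by
  obtain ⟨p, hp⟩ := exists_eq_comp_X_sq_of_comp_neg_X_eq hPeven
  have hD : (∏ j : Fin (2 * k), (X ^ 2 - C (z j ^ 2))) ≠ 0 :=
    (monic_prod_of_monic _ _ fun j _ => monic_X_pow_sub_C _ two_ne_zero).ne_zero
  have hQ : Q.comp (-X) = Q := by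
    have hsq : (Q.comp (-X)) ^ 2 = Q ^ 2 := by
      have h := congrArg (·.comp (-X)) hPell
      simp only [sub_comp, mul_comp, pow_comp, hPeven, prod_comp, X_comp, C_comp, one_comp,
        neg_sq] at h
      exact mul_left_cancel₀ hD (by linear_combination hPell - h)
    rcases sq_eq_sq_iff_eq_or_eq_neg.mp hsq with h | h
    · exact h
    by_cases hQ0 : Q = 0
    · simp [hQ0]
    have hdeg := natDegree_sub_C (p := P ^ 2) (a := 1)
    rw [C_1, show P ^ 2 - 1 = (∏ j : Fin (2 * k), (X ^ 2 - C (z j ^ 2))) * Q ^ 2 by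
      linear_combination hPell, natDegree_mul hD (pow_ne_zero 2 hQ0),
      natDegree_prod_X_sq_sub_C, Fintype.card_fin, natDegree_pow, natDegree_pow] at hdeg
    have hPe := even_natDegree_of_comp_neg_X_eq hPeven
    have hQo := odd_natDegree_of_comp_neg_X_eq_neg h hQ0
    grind
  obtain ⟨q, hq⟩ := exists_eq_comp_X_sq_of_comp_neg_X_eq hQ
  refine ⟨p, q, hp, hq, expand_injective two_pos ?_⟩
  simp only [expand_eq_comp_X_pow, sub_comp, mul_comp, pow_comp, prod_comp, X_comp, C_comp,
    one_comp, ← hp, ← hq]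
  exact hPell
end

section
/- Let k ≥ 0 and let z_1, …, z_{2k+1} be real numbers with 0 < z_1 < z_2 < ⋯ < z_{2k+1}. Let P and Q be real polynomials such that P is odd, P is nonconstant, and P(z)² − (∏_{j=1}^{2k+1} (z² − z_j²)) · Q(z)² = 1 as polynomials. Then there exist real polynomials p̂ and q̂ such that P(z) = z·p̂(z²), Q(z) = q̂(z²), and w·p̂(w)² − (∏_{j=1}^{2k+1} (w − z_j²)) · q̂(w)² = 1 as polynomials in w. -/
open Polynomial

namespace Polynomial

theorem coeff_comp_neg_X {R : Type*} [CommRing R] (f : R[X]) (n : ℕ) :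
    (f.comp (-X)).coeff n = (-1) ^ n * f.coeff n := by
  rw [← neg_one_mul (X : R[X]), ← C_1, ← C_neg, comp_C_mul_X_coeff, mul_comm]

variable {R : Type*} [CommRing R] [NoZeroDivisors R] [CharZero R]

theorem expand_two_contract_of_comp_neg_X_eq_self {f : R[X]} (hf : f.comp (-X) = f) :
    expand R 2 (contract 2 f) = f := by
  ext n
  rw [coeff_expand two_pos, coeff_contract two_ne_zero]
  split_ifs with h
  · rw [Nat.div_mul_cancel h]
  · have hn : Odd n := Nat.not_even_iff_odd.1 fun he => h he.two_dvd
    have hc := congrArg (fun g => coeff g n) hf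
    simp only [coeff_comp_neg_X, hn.neg_one_pow, neg_mul, one_mul] at hc
    exact (neg_eq_self.1 hc).symm

theorem coeff_zero_eq_zero_of_comp_neg_X_eq_neg {f : R[X]} (hf : f.comp (-X) = -f) :
    f.coeff 0 = 0 := by
  have hc := congrArg (fun g => coeff g 0) hf
  simp only [coeff_comp_neg_X, pow_zero, one_mul, coeff_neg] at hc
  exact self_eq_neg.1 hc

theorem exists_eq_X_mul_expand_two_of_comp_neg_X_eq_neg {f : R[X]} (hf : f.comp (-X) = -f) :
    ∃ p : R[X], f = X * expand R 2 p := by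
  have : IsDomain R := NoZeroDivisors.to_isDomain R
  obtain ⟨g, rfl⟩ := X_dvd_iff.2 (coeff_zero_eq_zero_of_comp_neg_X_eq_neg hf)
  refine ⟨contract 2 g, ?_⟩
  rw [expand_two_contract_of_comp_neg_X_eq_self]
  rw [mul_comp, X_comp, neg_mul, neg_inj] at hf
  exact mul_left_cancel₀ X_ne_zero hf

end Polynomial

/-- First assertion of Proposition 8.2(ii): an odd nonconstant solution of the Pell equation with
`Δ(z) = ∏_{j=1}^{2k+1}(z² − z_j²)`, `0 < z_1 < ⋯ < z_{2k+1}`, descends to a solution of the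
modified Pell equation `w·p̂(w)² − ∏_{j=1}^{2k+1}(w − z_j²)·q̂(w)² = 1`. -/
theorem stmt4 (k : ℕ) (z : Fin (2 * k + 1) → ℝ)
    (hzpos : ∀ j, 0 < z j) (hzmono : StrictMono z)
    (P Q : Polynomial ℝ)
    (hPodd : P.comp (-Polynomial.X) = -P) (hPnc : 0 < P.natDegree)
    (hPell : P ^ 2 -
        (∏ j : Fin (2 * k + 1), (Polynomial.X ^ 2 - Polynomial.C (z j ^ 2))) * Q ^ 2 = 1) :
    ∃ p q : Polynomial ℝ,
      P = Polynomial.X * p.comp (Polynomial.X ^ 2) ∧ Q = q.comp (Polynomial.X ^ 2) ∧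
      Polynomial.X * p ^ 2 -
        (∏ j : Fin (2 * k + 1), (Polynomial.X - Polynomial.C (z j ^ 2))) * q ^ 2 = 1 := by
  have hD : expand ℝ 2 (∏ j : Fin (2 * k + 1), (X - C (z j ^ 2))) =
      ∏ j : Fin (2 * k + 1), (X ^ 2 - C (z j ^ 2)) := by
    simp only [map_prod, map_sub, expand_X, expand_C]
  have hD0 : (∏ j : Fin (2 * k + 1), (X ^ 2 - C (z j ^ 2)) : ℝ[X]) ≠ 0 := by
    rw [← hD, expand_ne_zero two_pos]
    exact (monic_prod_of_monic _ _ fun j _ => monic_X_sub_C (z j ^ 2)).ne_zero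
  have hP0 := coeff_zero_eq_zero_of_comp_neg_X_eq_neg hPodd
  have hsq : Q.comp (-X) ^ 2 = Q ^ 2 := by
    have h := congrArg (fun f : ℝ[X] => f.comp (-X)) hPell
    simp only [sub_comp, mul_comp, pow_comp, prod_comp, X_comp, C_comp, one_comp, hPodd,
      neg_sq] at h
    exact mul_left_cancel₀ hD0 (sub_right_injective (h.trans hPell.symm))
  have hQeven : Q.comp (-X) = Q := by
    refine (sq_eq_sq_iff_eq_or_eq_neg.1 hsq).resolve_right fun hQodd => ?_
    have hQ0 := coeff_zero_eq_zero_of_comp_neg_X_eq_neg hQodd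
    have h := congrArg (eval 0) hPell
    rw [coeff_zero_eq_eval_zero] at hP0 hQ0
    simp [eval_mul, hP0, hQ0] at h
  obtain ⟨p, hp⟩ := exists_eq_X_mul_expand_two_of_comp_neg_X_eq_neg hPodd
  have hq := expand_two_contract_of_comp_neg_X_eq_self hQeven
  refine ⟨p, contract 2 Q, by rwa [← expand_eq_comp_X_pow],
    by rw [← expand_eq_comp_X_pow, hq], expand_injective two_pos ?_⟩
  rw [map_sub, map_mul, map_mul, map_pow, map_pow, expand_X, hD, hq, map_one, ← mul_pow, ← hp,
    hPell]
end

section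
/- Let k ≥ 0 and let z_1, …, z_{2k+1} be real numbers with 0 < z_1 < z_2 < ⋯ < z_{2k+1}. Let P and Q be real polynomials such that P is even, P is nonconstant, and P(z)² − (∏_{j=1}^{2k+1} (z² − z_j²)) · Q(z)² = 1 as polynomials. Then there exist real polynomials p̂ and q̂ such that P(z) = p̂(z²), Q(z) = z·q̂(z²), and p̂(w)² − w·(∏_{j=1}^{2k+1} (w − z_j²)) · q̂(w)² = 1 as polynomials in w. -/
open Polynomial

namespace Polynomial

/-- An even polynomial is a polynomial in `X ^ 2`. -/
theorem expand_contract_two_of_even {R : Type*} [CommRing R] [IsDomain R] [CharZero R]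
    {f : R[X]} (hf : f.comp (-X) = f) : expand R 2 (contract 2 f) = f := by
  ext n
  rw [coeff_expand two_pos, coeff_contract two_ne_zero]
  split_ifs with h
  · rw [Nat.div_mul_cancel h]
  · have hn := congrArg (fun g => g.coeff n) hf
    have hodd : Odd n := by rwa [← Nat.not_even_iff_odd, even_iff_two_dvd]
    simp only [coeff_comp_neg_X, hodd.neg_one_pow, neg_one_mul] at hn
    exact (neg_eq_self.mp hn).symm

/-- An odd polynomial is `X` times a polynomial in `X ^ 2`. -/
theorem exists_eq_X_mul_expand_two_of_odd {R : Type*} [CommRing R] [IsDomain R] [CharZero R]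
    {f : R[X]} (hf : f.comp (-X) = -f) : ∃ g : R[X], f = X * expand R 2 g := by
  have h0 : f.coeff 0 = 0 := by
    have h := congrArg (fun g => g.coeff 0) hf
    simp only [coeff_comp_neg_X, pow_zero, one_mul, coeff_neg] at h
    exact self_eq_neg.mp h
  obtain ⟨g, rfl⟩ := X_dvd_iff.mpr h0
  refine ⟨contract 2 g, ?_⟩
  rw [expand_contract_two_of_even]
  rw [mul_comp, X_comp, neg_mul, neg_inj] at hf
  exact mul_left_cancel₀ X_ne_zero hf

/-- A Pell equation with a coefficient of odd degree has only constant solutions. -/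
theorem natDegree_eq_zero_of_pell_of_odd {R : Type*} [CommRing R] [IsDomain R]
    {D p q : R[X]} (hD : Odd D.natDegree) (h : p ^ 2 - D * q ^ 2 = 1) : p.natDegree = 0 := by
  have hdeg : (D * q ^ 2).natDegree = 2 * p.natDegree := by
    rw [← natDegree_pow, ← natDegree_sub_C (p := p ^ 2) (a := 1), C_1, ← h, sub_sub_cancel]
  rcases eq_or_ne q 0 with rfl | hq
  · simpa using hdeg.symm
  · have hD0 : D ≠ 0 := by
      rintro rfl
      simp at hD
    rw [natDegree_mul hD0 (pow_ne_zero 2 hq), natDegree_pow] at hdeg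
    obtain ⟨m, hm⟩ := hD
    omega

end Polynomial

/-- Proposition 8.2(iii): an even nonconstant solution of the Pell equation with
`Δ(z) = ∏_{j=1}^{2k+1}(z² − z_j²)`, `0 < z_1 < ⋯ < z_{2k+1}`, descends to a solution of the
Pell equation `p̂² − w·∏_{j=1}^{2k+1}(w − z_j²)·q̂² = 1`. -/
theorem stmt6 (k : ℕ) (z : Fin (2 * k + 1) → ℝ)
    (hzpos : ∀ j, 0 < z j) (hzmono : StrictMono z)
    (P Q : Polynomial ℝ)
    (hPeven : P.comp (-Polynomial.X) = P) (hPnc : 0 < P.natDegree)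
    (hPell : P ^ 2 -
        (∏ j : Fin (2 * k + 1), (Polynomial.X ^ 2 - Polynomial.C (z j ^ 2))) * Q ^ 2 = 1) :
    ∃ p q : Polynomial ℝ,
      P = p.comp (Polynomial.X ^ 2) ∧ Q = Polynomial.X * q.comp (Polynomial.X ^ 2) ∧
      p ^ 2 - Polynomial.X *
        (∏ j : Fin (2 * k + 1), (Polynomial.X - Polynomial.C (z j ^ 2))) * q ^ 2 = 1 := by
  set D : ℝ[X] := ∏ j : Fin (2 * k + 1), (X - C (z j ^ 2)) with hD
  have hDmonic : D.Monic := monic_prod_of_monic _ _ fun j _ => monic_X_sub_C _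
  have hDdeg : Odd D.natDegree := ⟨k, by
    rw [hD, natDegree_finsetProd_X_sub_C_eq_card, Finset.card_fin]⟩
  have hDexp : ∏ j : Fin (2 * k + 1), (X ^ 2 - C (z j ^ 2)) = expand ℝ 2 D := by
    simp only [hD, map_prod, map_sub, expand_X, expand_C]
  rw [hDexp] at hPell
  obtain ⟨p, rfl⟩ : ∃ p, P = expand ℝ 2 p := ⟨_, (expand_contract_two_of_even hPeven).symm⟩
  have hsq : (Q.comp (-X)) ^ 2 = Q ^ 2 := by
    have hDeven : (expand ℝ 2 D).comp (-X) = expand ℝ 2 D := by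
      simp [expand_eq_comp_X_pow, comp_assoc]
    have h := congrArg (fun f : ℝ[X] => f.comp (-X)) hPell
    simp only [sub_comp, mul_comp, pow_comp, hPeven, hDeven, one_comp] at h
    have hD0 : expand ℝ 2 D ≠ 0 := (expand_ne_zero two_pos).mpr hDmonic.ne_zero
    exact mul_left_cancel₀ hD0 (sub_right_injective (h.trans hPell.symm))
  rcases sq_eq_sq_iff_eq_or_eq_neg.mp hsq with hQ | hQ
  · obtain ⟨q, rfl⟩ : ∃ q, Q = expand ℝ 2 q := ⟨_, (expand_contract_two_of_even hQ).symm⟩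
    have hpell : p ^ 2 - D * q ^ 2 = 1 := expand_injective two_pos (by simpa using hPell)
    simp [natDegree_expand, natDegree_eq_zero_of_pell_of_odd hDdeg hpell] at hPnc
  · obtain ⟨q, rfl⟩ := exists_eq_X_mul_expand_two_of_odd hQ
    refine ⟨p, q, expand_eq_comp_X_pow 2, by rw [expand_eq_comp_X_pow],
      expand_injective two_pos ?_⟩
    simp only [map_sub, map_mul, map_pow, map_one, expand_X]
    rw [← hPell]
    ring
end

section
/- Let g ≥ 1 and let real numbers satisfy 1 < x_1 < u_1 < x_2 < u_2 < ⋯ < x_g < u_g; set u_0 := 1 and Δ(t) := t(t−1)·∏_{j=1}^{g} (t − x_j)(t − u_j). Suppose q is a monic real polynomial of degree g such that ∫_{u_{j−1}}^{x_j} q(t)/√(Δ(t)) dt = 0 for every j = 1, …, g (note that Δ(t) > 0 on each open gap interval (u_{j−1}, x_j)). Then q has exactly one root in each open interval (u_{j−1}, x_j), each of these roots is simple, and q has no other roots in ℂ. -/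
open Polynomial MeasureTheory

/-- The left endpoint `u_{j-1}` of the `j`-th gap interval, with the convention `u_0 = 1`. -/
noncomputable def gapLeft (g : ℕ) (u : Fin g → ℝ) (j : Fin g) : ℝ :=
  if h : (j : ℕ) = 0 then 1
  else u ⟨(j : ℕ) - 1, lt_of_le_of_lt (Nat.sub_le _ _) j.isLt⟩

/-- The arcsine density `1 / √((t - a) (b - t))` is integrable on `[a, b]`. -/
theorem intervalIntegrable_one_div_sqrt_mul {a b : ℝ} (hab : a < b) :
    IntervalIntegrable (fun t => 1 / √((t - a) * (b - t))) volume a b := by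
  have hba : 0 < b - a := sub_pos.2 hab
  refine intervalIntegral.intervalIntegrable_deriv_of_nonneg
    (g := fun t => Real.arcsin ((2 * t - a - b) / (b - a))) ?_ ?_ ?_
  · fun_prop
  · intro t ht
    rw [min_eq_left hab.le, max_eq_right hab.le] at ht
    have h1 : 0 < t - a := sub_pos.2 ht.1
    have h2 : 0 < b - t := sub_pos.2 ht.2
    have hne : (2 * t - a - b) / (b - a) ≠ -1 := by
      rw [Ne, div_eq_iff hba.ne']; intro h; linarith
    have hne' : (2 * t - a - b) / (b - a) ≠ 1 := by
      rw [Ne, div_eq_iff hba.ne']; intro h; linarith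
    have hd : HasDerivAt (fun t => (2 * t - a - b) / (b - a)) (2 / (b - a)) t := by
      simpa using ((((hasDerivAt_id t).const_mul 2).sub_const a).sub_const b).div_const (b - a)
    refine ((Real.hasDerivAt_arcsin hne hne').comp t hd).congr_deriv ?_
    have hs : 1 - ((2 * t - a - b) / (b - a)) ^ 2 = (2 / (b - a)) ^ 2 * ((t - a) * (b - t)) := by
      field_simp; ring
    have hpos : 0 < √((t - a) * (b - t)) := Real.sqrt_pos.2 (mul_pos h1 h2)
    rw [hs, Real.sqrt_mul (by positivity), Real.sqrt_sq (by positivity)]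
    field_simp
  · intro t _
    positivity

/-- A polynomial whose integral against `1 / √Δ` over `[a, b]` vanishes has a root in `(a, b)`,
if `Δ` has exactly two simple zeros `a`, `b` in `[a, b]` and is positive in between. -/
theorem exists_isRoot_of_integral_div_sqrt_eq_zero {a b : ℝ} (hab : a < b) {D h : ℝ → ℝ}
    (hD : ∀ t, D t = (t - a) * (b - t) * h t) (hcont : Continuous h)
    (hpos : ∀ t ∈ Set.Icc a b, 0 < h t) (q : ℝ[X])
    (hint : ∫ t in a..b, q.eval t / √(D t) = 0) :
    ∃ r ∈ Set.Ioo a b, q.IsRoot r := by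
  by_contra! hroot
  have hii : IntervalIntegrable (fun t => q.eval t / √(D t)) volume a b := by
    have hc : ContinuousOn (fun t => q.eval t / √(h t)) (Set.uIcc a b) := by
      rw [Set.uIcc_of_le hab.le]
      exact q.continuous.continuousOn.div (Real.continuous_sqrt.comp hcont).continuousOn
        fun t ht => (Real.sqrt_pos.2 (hpos t ht)).ne'
    refine ((intervalIntegrable_one_div_sqrt_mul hab).mul_continuousOn hc).congr ?_
    intro t ht
    rw [Set.uIoc_of_le hab.le] at ht
    dsimp only
    rw [hD, Real.sqrt_mul (mul_nonneg (by linarith [ht.1]) (by linarith [ht.2])),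
      div_mul_div_comm, one_mul]
  have hDpos : ∀ t ∈ Set.Ioo a b, 0 < √(D t) := fun t ht => by
    rw [hD]
    exact Real.sqrt_pos.2 (mul_pos (mul_pos (sub_pos.2 ht.1) (sub_pos.2 ht.2))
      (hpos t (Set.Ioo_subset_Icc_self ht)))
  have hsign : (∀ t ∈ Set.Ioo a b, 0 < q.eval t) ∨ (∀ t ∈ Set.Ioo a b, q.eval t < 0) := by
    by_contra! hc
    obtain ⟨⟨s, hs, hqs⟩, ⟨t, ht, hqt⟩⟩ := hc
    obtain ⟨r, hr, hr0⟩ := isPreconnected_Ioo.intermediate_value hs ht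
      q.continuous.continuousOn ⟨hqs, hqt⟩
    exact hroot r hr hr0
  rcases hsign with hs | hs
  · exact (intervalIntegral.intervalIntegral_pos_of_pos_on hii
      (fun t ht => div_pos (hs t ht) (hDpos t ht)) hab).ne' hint
  · refine (intervalIntegral.intervalIntegral_pos_of_pos_on hii.neg
      (fun t ht => neg_pos.2 (div_neg_of_neg_of_pos (hs t ht) (hDpos t ht))) hab).ne' ?_
    simp [intervalIntegral.integral_neg, hint]

/-- A monic polynomial of degree `g` with `g` distinct roots `r j` is the product of the
`X - r j`. -/
theorem Polynomial.Monic.eq_prod_X_sub_C_of_injective {g : ℕ} {q : ℝ[X]} (hq : q.Monic)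
    (hdeg : q.natDegree = g) {r : Fin g → ℝ} (hr : Function.Injective r)
    (hroot : ∀ j, q.IsRoot (r j)) :
    q.roots = Finset.univ.val.map r ∧ q = ∏ j, (X - C (r j)) := by
  have hle : Finset.univ.val.map r ≤ q.roots := by
    rw [Multiset.le_iff_subset (Finset.univ.nodup.map hr)]
    intro y hy
    obtain ⟨j, -, rfl⟩ := Multiset.mem_map.1 hy
    exact (mem_roots hq.ne_zero).2 (hroot j)
  have heq : q.roots = Finset.univ.val.map r :=
    (Multiset.eq_of_le_of_card_le hle (by simpa [hdeg] using q.card_roots')).symm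
  refine ⟨heq, ?_⟩
  have := prod_multiset_X_sub_C_of_monic_of_roots_card_eq hq (by simp [heq, hdeg])
  rw [heq, Multiset.map_map] at this
  exact this.symm

theorem gapLeft_zero (n : ℕ) (u : Fin (n + 1) → ℝ) : gapLeft (n + 1) u 0 = 1 := by
  simp [gapLeft]

theorem gapLeft_succ (n : ℕ) (u : Fin (n + 1) → ℝ) (i : Fin n) :
    gapLeft (n + 1) u i.succ = u i.castSucc := by
  simp [gapLeft]
  rfl

/-- The zeros of the monic degree-`g` polynomial `q` with vanishing periods:
`q` has exactly one root in each gap interval `(u_{j-1}, x_j)`, each of these roots is simple,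
and `q` has no other roots in `ℂ`. (Section 6 of the paper.) -/
theorem stmt7 (g : ℕ) (hg : 1 ≤ g) (x u : Fin g → ℝ)
    (hx1 : ∀ j : Fin g, (j : ℕ) = 0 → 1 < x j)
    (hxu : ∀ j : Fin g, x j < u j)
    (hux : ∀ j j' : Fin g, (j' : ℕ) = (j : ℕ) + 1 → u j < x j')
    (q : Polynomial ℝ) (hmonic : q.Monic) (hdeg : q.natDegree = g)
    (hint : ∀ j : Fin g,
      ∫ t in gapLeft g u j..(x j),
        q.eval t / Real.sqrt ((Polynomial.X * (Polynomial.X - 1) *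
          ∏ i : Fin g,
            ((Polynomial.X - Polynomial.C (x i)) * (Polynomial.X - Polynomial.C (u i)))).eval t)
        = 0) :
    (∀ j : Fin g, ∃! r : ℝ, r ∈ Set.Ioo (gapLeft g u j) (x j) ∧ q.IsRoot r) ∧
    (∀ r : ℝ, q.IsRoot r →
      Polynomial.rootMultiplicity r q = 1 ∧ ∃ j : Fin g, r ∈ Set.Ioo (gapLeft g u j) (x j)) ∧
    (∀ zc : ℂ, Polynomial.aeval zc q = 0 → ∃ r : ℝ, zc = (r : ℂ)) := by
  obtain ⟨n, rfl⟩ : ∃ n, g = n + 1 := ⟨g - 1, by omega⟩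
  have hu : StrictMono u := Fin.strictMono_iff_lt_succ.2 fun i =>
    (hux i.castSucc i.succ (by simp)).trans (hxu _)
  have hax : ∀ j, gapLeft (n + 1) u j < x j := by
    intro j
    cases j using Fin.cases with
    | zero => rw [gapLeft_zero]; exact hx1 0 rfl
    | succ i => rw [gapLeft_succ]; exact hux _ _ (by simp)
  have hua : ∀ i j, i < j → u i ≤ gapLeft (n + 1) u j := by
    intro i j hij
    cases j using Fin.cases with
    | zero => exact absurd hij (Fin.not_lt_zero i)
    | succ k => rw [gapLeft_succ]; exact hu.monotone (Fin.le_castSucc_iff.2 hij)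
  have hxa : ∀ i j, i < j → x i < gapLeft (n + 1) u j := fun i j hij =>
    (hxu i).trans_le (hua i j hij)
  have ha : ∀ j, 1 ≤ gapLeft (n + 1) u j := by
    intro j
    rcases eq_or_ne j 0 with rfl | hj
    · rw [gapLeft_zero]
    · exact ((hx1 0 rfl).trans (hxa 0 j (Fin.pos_iff_ne_zero.2 hj))).le
  have hex : ∀ j, ∃ r ∈ Set.Ioo (gapLeft (n + 1) u j) (x j), q.IsRoot r := by
    intro j
    refine exists_isRoot_of_integral_div_sqrt_eq_zero (hax j)
      (h := fun t => t * (u (Fin.last n) - t) *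
        ∏ i ∈ Finset.univ.erase j, ((t - gapLeft (n + 1) u i) * (t - x i)))
      (fun t => ?_) (by fun_prop) (fun t ht => ?_) q (hint j)
    · have hshift : (t - 1) * ∏ i, (t - u i) =
          (∏ i, (t - gapLeft (n + 1) u i)) * (t - u (Fin.last n)) := by
        rw [Fin.prod_univ_castSucc (fun i => t - u i),
          Fin.prod_univ_succ (fun i => t - gapLeft (n + 1) u i), gapLeft_zero]
        simp only [gapLeft_succ]
        ring
      have hsplit := Finset.mul_prod_erase Finset.univ
        (fun i => (t - gapLeft (n + 1) u i) * (t - x i)) (Finset.mem_univ j)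
      rw [Finset.prod_mul_distrib (s := Finset.univ)] at hsplit
      simp only [eval_mul, eval_sub, eval_X, eval_one, eval_prod, eval_C,
        Finset.prod_mul_distrib (s := Finset.univ)]
      linear_combination (t * ∏ i, (t - x i)) * hshift - t * (t - u (Fin.last n)) * hsplit
    · have hul : t < u (Fin.last n) :=
        ht.2.trans_lt ((hxu j).trans_le (hu.monotone (Fin.le_last j)))
      refine mul_pos (mul_pos (by linarith [ha j, ht.1]) (sub_pos.2 hul))
        (Finset.prod_pos fun i hi => ?_)
      rcases lt_or_gt_of_ne (Finset.ne_of_mem_erase hi) with hij | hij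
      · have := hxa i j hij
        exact mul_pos (by linarith [ht.1, hax i]) (by linarith [ht.1])
      · have := hxa j i hij
        exact mul_pos_of_neg_of_neg (by linarith [ht.2]) (by linarith [ht.2, hax i])
  choose r hr hroot using hex
  have hmono : StrictMono r := fun i j hij =>
    (hr i).2.trans ((hxa i j hij).trans (hr j).1)
  obtain ⟨hroots, hprod⟩ := hmonic.eq_prod_X_sub_C_of_injective hdeg hmono.injective hroot
  have hall : ∀ s, q.IsRoot s → ∃ j, r j = s := by
    intro s hs
    have := (mem_roots hmonic.ne_zero).2 hs
    rw [hroots] at this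
    obtain ⟨j, -, hj⟩ := Multiset.mem_map.1 this
    exact ⟨j, hj⟩
  refine ⟨fun j => ⟨r j, ⟨hr j, hroot j⟩, ?_⟩, fun s hs => ⟨?_, ?_⟩, fun z hz => ?_⟩
  · rintro s ⟨hs, hs0⟩
    obtain ⟨i, rfl⟩ := hall s hs0
    rcases lt_trichotomy i j with hij | rfl | hij
    · linarith [(hr i).2, hxa i j hij, hs.1]
    · rfl
    · linarith [(hr i).1, hxa j i hij, hs.2]
  · rw [← count_roots]
    refine Multiset.count_eq_one_of_mem ?_ ((mem_roots hmonic.ne_zero).2 hs)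
    rw [hroots]
    exact Finset.univ.nodup.map hmono.injective
  · obtain ⟨j, rfl⟩ := hall s hs
    exact ⟨j, hr j⟩
  · rw [hprod, map_prod, Finset.prod_eq_zero_iff] at hz
    obtain ⟨j, -, hj⟩ := hz
    refine ⟨r j, ?_⟩
    simpa [sub_eq_zero] using hj
end

section
/- Let g ≥ 1, let u_1, …, u_g be pairwise distinct complex numbers, let m ∈ {1,…,g}, and let x be a complex number with x ≠ u_m. Then (∏_{α=1, α≠m}^{g} (x − u_α)/(u_m − u_α)) · (1/(x − u_m) − ∑_{α=1, α≠m}^{g} 1/(u_m − u_α)) = 1/(x − u_m) − ∑_{k=1, k≠m}^{g} (∏_{α=1, α≠k}^{g} (x − u_α)) / ((u_k − u_m) · ∏_{α=1, α≠k}^{g} (u_k − u_α)). -/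
open Finset

open Polynomial in
theorem Lagrange.eval_derivative_basis_self {F ι : Type*} [Field F] [DecidableEq ι] {s : Finset ι}
    {v : ι → F} {i : ι} (hvs : Set.InjOn v s) (hi : i ∈ s) :
    (derivative (Lagrange.basis s v i)).eval (v i) = ∑ j ∈ s.erase i, 1 / (v i - v j) := by
  have hne : ∀ j ∈ s.erase i, v i ≠ v j := fun j hj h =>
    (mem_erase.1 hj).1 (hvs (mem_erase.1 hj).2 hi h.symm)
  rw [Lagrange.basis, derivative_prod_finset, eval_finsetSum]
  refine sum_congr rfl fun j hj => ?_
  rw [eval_mul, eval_prod, prod_eq_one fun k hk =>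
    Lagrange.eval_basisDivisor_left_of_ne (hne k (mem_of_mem_erase hk))]
  simp [Lagrange.basisDivisor]

open Polynomial in
/-- Partial Hermite interpolation of the constant `1`: the polynomial taking the value `1` at
`v i` with vanishing derivative there, and vanishing at the other nodes. -/
theorem Lagrange.one_sub_basis_mul_eq_sum {F ι : Type*} [Field F] [DecidableEq ι] {s : Finset ι}
    {v : ι → F} {i : ι} (hvs : Set.InjOn v s) (hi : i ∈ s) :
    1 - Lagrange.basis s v i * (1 - C (∑ j ∈ s.erase i, 1 / (v i - v j)) * (X - C (v i))) =
      (X - C (v i)) * ∑ k ∈ s.erase i, C (1 / (v k - v i)) * Lagrange.basis s v k := by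
  set c := ∑ j ∈ s.erase i, 1 / (v i - v j) with hc
  set p := 1 - Lagrange.basis s v i * (1 - C c * (X - C (v i))) with hp
  have hroot : p.IsRoot (v i) := by
    simp [hp, Lagrange.eval_basis_self hvs hi]
  obtain ⟨q, hq⟩ := dvd_iff_isRoot.2 hroot
  have hqi : q.eval (v i) = 0 := by
    have h := congrArg (fun f => (derivative f).eval (v i)) hq
    have hd := Lagrange.eval_derivative_basis_self hvs hi
    rw [← hc] at hd
    clear_value c
    simpa [hp, Lagrange.eval_basis_self hvs hi, hd] using h.symm
  have hqk : ∀ k ∈ s.erase i, q.eval (v k) = 1 / (v k - v i) := by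
    intro k hk
    obtain ⟨hki, hks⟩ := mem_erase.1 hk
    have hne : v k - v i ≠ 0 := sub_ne_zero.2 fun h => hki (hvs hks hi h)
    have h := congrArg (fun f => f.eval (v k)) hq
    simp only [hp, eval_sub, eval_mul, Lagrange.eval_basis_of_ne hki.symm hks, eval_one, zero_mul,
      sub_zero, eval_X, eval_C] at h
    rw [eq_div_iff hne, mul_comm, h]
  have hcard : 0 < #s := card_pos.2 ⟨i, hi⟩
  have hpdeg : p.natDegree ≤ #s := by
    have h1 : (1 - C c * (X - C (v i))).natDegree ≤ 1 := by compute_degree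
    have h2 := natDegree_mul_le (p := Lagrange.basis s v i) (q := 1 - C c * (X - C (v i)))
    have h3 := natDegree_sub_le (1 : F[X]) (Lagrange.basis s v i * (1 - C c * (X - C (v i))))
    rw [Lagrange.natDegree_basis hvs hi] at h2
    rw [natDegree_one, ← hp] at h3
    omega
  have hqdeg : q.degree < #s := by
    rcases eq_or_ne q 0 with rfl | hq0
    · simp
    · rw [hq, natDegree_mul (X_sub_C_ne_zero _) hq0, natDegree_X_sub_C] at hpdeg
      rw [degree_eq_natDegree hq0]
      exact_mod_cast (by omega : q.natDegree < #s)
  rw [hq, Lagrange.eq_interpolate hvs hqdeg, Lagrange.interpolate_apply, ← add_sum_erase s _ hi,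
    hqi, C_0, zero_mul, zero_add]
  congr 1
  exact sum_congr rfl fun k hk => by rw [hqk k hk]

theorem Lagrange.eval_basis_eq_prod_div {F ι : Type*} [Field F] [DecidableEq ι] (s : Finset ι)
    (v : ι → F) (i : ι) (x : F) :
    (Lagrange.basis s v i).eval x = ∏ j ∈ s.erase i, (x - v j) / (v i - v j) := by
  rw [Lagrange.basis, Polynomial.eval_prod]
  refine prod_congr rfl fun j _ => ?_
  simp [Lagrange.basisDivisor, div_eq_inv_mul]

/-- Rational identity from the proof of Theorem 9.1, a consequence of the second identity of
Lemma 4.2. -/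
theorem stmt9 (g : ℕ) (hg : 1 ≤ g) (u : Fin g → ℂ) (hu : Function.Injective u)
    (m : Fin g) (x : ℂ) (hx : x ≠ u m) :
    (∏ α ∈ Finset.univ.erase m, (x - u α) / (u m - u α)) *
        (1 / (x - u m) - ∑ α ∈ Finset.univ.erase m, 1 / (u m - u α)) =
      1 / (x - u m) - ∑ k ∈ Finset.univ.erase m, (∏ α ∈ Finset.univ.erase k, (x - u α)) /
        ((u k - u m) * ∏ α ∈ Finset.univ.erase k, (u k - u α)) := by
  have hxm : x - u m ≠ 0 := sub_ne_zero.2 hx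
  have hsum : ∑ k ∈ univ.erase m, (∏ α ∈ univ.erase k, (x - u α)) /
      ((u k - u m) * ∏ α ∈ univ.erase k, (u k - u α)) =
      ∑ k ∈ univ.erase m, 1 / (u k - u m) * (Lagrange.basis univ u k).eval x := by
    refine sum_congr rfl fun k _ => ?_
    rw [Lagrange.eval_basis_eq_prod_div, prod_div_distrib, div_mul_div_comm, one_mul]
  have h := congrArg (Polynomial.eval x)
    (Lagrange.one_sub_basis_mul_eq_sum (s := univ) hu.injOn (mem_univ m))
  simp only [Polynomial.eval_sub, Polynomial.eval_mul, Polynomial.eval_one, Polynomial.eval_C,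
    Polynomial.eval_X, Polynomial.eval_finsetSum] at h
  rw [hsum, ← Lagrange.eval_basis_eq_prod_div]
  generalize ∑ k ∈ univ.erase m, 1 / (u k - u m) * (Lagrange.basis univ u k).eval x = R at h ⊢
  generalize ∑ α ∈ univ.erase m, 1 / (u m - u α) = c at h ⊢
  field_simp
  linear_combination -h
end

section
/- Let D, p̂, q̂, p̃ be real polynomials in the variable w with p̂ ≠ 0, and let δ be a nonzero real number. Assume that p̃(w) + 1 = δ·w·p̂(w)² and p̃(w)² − 1 = 4w·D(w)·p̂(w)²·q̂(w)² as polynomials. Then p̃(w) − 1 = (4/δ)·D(w)·q̂(w)², and consequently (δ/2)·w·p̂(w)² − (2/δ)·D(w)·q̂(w)² = 1. -/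
open Polynomial

/-- Key algebraic step in the proof of Theorem 8.3(iii): from `p̃ + 1 = δ·w·p̂²` and
`p̃² − 1 = 4w·D·p̂²·q̂²` (with `p̂ ≠ 0`, `δ ≠ 0`) it follows that `p̃ − 1 = (4/δ)·D·q̂²` and
`(δ/2)·w·p̂² − (2/δ)·D·q̂² = 1`. -/
theorem stmt12 (D p q pt : Polynomial ℝ) (hp : p ≠ 0) (δ : ℝ) (hδ : δ ≠ 0)
    (h1 : pt + 1 = Polynomial.C δ * Polynomial.X * p ^ 2)
    (h2 : pt ^ 2 - 1 = 4 * Polynomial.X * D * p ^ 2 * q ^ 2) :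
    pt - 1 = Polynomial.C (4 / δ) * D * q ^ 2 ∧
      Polynomial.C (δ / 2) * Polynomial.X * p ^ 2 -
        Polynomial.C (2 / δ) * D * q ^ 2 = 1 := by
  have hCδ : (C (4 / δ) * C δ : ℝ[X]) = 4 := by
    rw [← C_mul, div_mul_cancel₀ _ hδ]
    rfl
  have hne : C δ * X * p ^ 2 ≠ 0 :=
    mul_ne_zero (mul_ne_zero (C_ne_zero.mpr hδ) X_ne_zero) (pow_ne_zero 2 hp)
  have hsub : pt - 1 = C (4 / δ) * D * q ^ 2 := by
    apply mul_left_cancel₀ hne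
    linear_combination h2 - (pt - 1) * h1 - X * p ^ 2 * D * q ^ 2 * hCδ
  refine ⟨hsub, ?_⟩
  have hhalf : (C (1 / 2) * 2 : ℝ[X]) = 1 := by
    rw [← C_ofNat, ← C_mul, one_div_mul_cancel two_ne_zero, C_1]
  have hδ_half : C (δ / 2) = C (1 / 2) * C δ := by
    rw [← C_mul]
    congr 1
    ring
  have hδ_inv : C (2 / δ) = C (1 / 2) * C (4 / δ) := by
    rw [← C_mul]
    congr 1
    ring
  rw [hδ_half, hδ_inv]
  linear_combination C (1 / 2) * (hsub - h1) + hhalf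
end
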